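/- Let ℓ_1, ..., ℓ_n : ℝ^d → ℝ be convex, G-Lipschitz, continuous functions, let s : (0,1) → [0,∞) be a bounded probability density, set σ_i := ∫_{(i−1)/n}^{i/n} s(t) dt, and let R_σ(w) := Σ_{i=1}^n σ_i ℓ_{(i)}(w). Fix a minibatch size m dividing n, weights σ̂_j := ∫_{(j−1)/m}^{j/m} s(t) dt, and for a uniformly random sample (i_1, ..., i_m) drawn without replacement from {1, ..., n} define R_σ̂(w) := Σ_{j=1}^m σ̂_j ℓ_{i_{(j)}}(w), where ℓ_{i_{(1)}}(w) ≤ ... ≤ ℓ_{i_{(m)}}(w) are the sorted minibatch losses. Then for μ > 0, sup_{w : ‖w‖₂ ≤ G/μ} |E[R_σ̂(w)] − R_σ(w)| ≤ ‖s − u‖_∞ ((n − m)/n) B, where u ≡ 1 is the uniform density on (0,1), ‖s − u‖_∞ := sup_{t ∈ (0,1)} |s(t) − u(t)|, and B := sup_{‖w‖₂ ≤ G/μ} (ℓ_{(n)}(w) − ℓ_{(1)}(w)) < ∞. -/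

import Mathlib

open scoped NNReal

noncomputable instance {m n : ℕ} : Fintype (Fin m ↪ Fin n) := Function.Embedding.fintype

/-- The spectral risk `R_σ(w) = ∑ᵢ σᵢ ℓ₍ᵢ₎(w)`, with the losses at `w` sorted in
non-decreasing order via `Tuple.sort`. -/
noncomputable def spectralRisk {d n : ℕ} (σ : Fin n → ℝ)
    (ℓ : Fin n → EuclideanSpace ℝ (Fin d) → ℝ) (w : EuclideanSpace ℝ (Fin d)) : ℝ :=
  ∑ i, σ i * ℓ (Tuple.sort (fun j => ℓ j w) i) w

theorem comp_perm_le_comp_perm_of_le {α : Type*} [LinearOrder α] {n : ℕ} {u w : Fin n → α}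
    {π ρ : Equiv.Perm (Fin n)} (hu : Monotone (u ∘ π)) (hw : Monotone (w ∘ ρ)) (h : u ≤ w) :
    u ∘ π ≤ w ∘ ρ := by
  intro r
  by_contra! hlt
  have hmaps : ∀ i ∈ Finset.Iic r, π.symm (ρ i) ∈ Finset.Iio r := by
    intro i hi
    rw [Finset.mem_Iic] at hi
    rw [Finset.mem_Iio]
    by_contra! hri
    have h₁ : u (π r) ≤ u (ρ i) := by simpa using hu hri
    exact absurd (h₁.trans ((h (ρ i)).trans (hw hi))) (not_le.mpr hlt)
  have hcard := Finset.card_le_card_of_injOn (fun i => π.symm (ρ i)) hmaps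
    (fun i _ j _ hij => by simpa using hij)
  simp at hcard

/-- Sorting two finite families decreases their `ℓ¹` distance. -/
theorem sum_abs_sub_comp_perm_le {n : ℕ} {u v : Fin n → ℝ} {π ρ : Equiv.Perm (Fin n)}
    (hu : Monotone (u ∘ π)) (hv : Monotone (v ∘ ρ)) :
    ∑ i, |u (π i) - v (ρ i)| ≤ ∑ i, |u i - v i| := by
  have habs : ∀ a b : ℝ, |a - b| = 2 * max a b - a - b := by
    intro a b
    rcases le_total a b with h | h
    · rw [max_eq_right h, abs_of_nonpos (by linarith)]; ring
    · rw [max_eq_left h, abs_of_nonneg (by linarith)]; ring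
  have hw : Monotone ((u ⊔ v) ∘ Tuple.sort (u ⊔ v)) := Tuple.monotone_sort _
  have hmax : ∑ i, max (u (π i)) (v (ρ i)) ≤ ∑ i, max (u i) (v i) :=
    calc ∑ i, max (u (π i)) (v (ρ i)) ≤ ∑ i, (u ⊔ v) (Tuple.sort (u ⊔ v) i) :=
          Finset.sum_le_sum fun i _ => max_le
            (comp_perm_le_comp_perm_of_le hu hw le_sup_left i)
            (comp_perm_le_comp_perm_of_le hv hw le_sup_right i)
      _ = ∑ i, max (u i) (v i) := Equiv.sum_comp (Tuple.sort (u ⊔ v)) (u ⊔ v)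
  simp only [habs, Finset.sum_sub_distrib, ← Finset.mul_sum, Equiv.sum_comp π u,
    Equiv.sum_comp ρ v]
  linarith

/-- The `ℓ¹` distance between the order statistics of `x` and those of a sample without
replacement of `x`, each of the latter repeated `k` times. -/
theorem sum_abs_sample_sub_le {m k : ℕ} [NeZero k] (x : Fin (m * k) → ℝ) (ι : Fin m ↪ Fin (m * k))
    {R : ℝ} (hR : ∀ i j, |x i - x j| ≤ R) :
    ∑ p : Fin m × Fin k, |x (ι (Tuple.sort (fun j => x (ι j)) p.1)) -
        x (Tuple.sort x (finProdFinEquiv p))| ≤ ((m * k : ℕ) - m : ℝ) * R := by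
  set z : Fin m → ℝ := fun j => x (ι j) with hz
  set y : Fin (m * k) → ℝ := fun r => z (Tuple.sort z (finProdFinEquiv.symm r).1) with hy
  have hymono : Monotone (y ∘ (1 : Equiv.Perm (Fin (m * k)))) := by
    intro a b hab
    refine Tuple.monotone_sort z ?_
    simp only [Equiv.Perm.coe_one, id_eq, finProdFinEquiv_symm_apply]
    exact Nat.div_le_div_right (Fin.le_def.mp hab)
  obtain ⟨g, hg⟩ : ∃ g : Equiv.Perm (Fin (m * k)),
      ∀ j, g (finProdFinEquiv (j, (0 : Fin k))) = ι (Tuple.sort z j) := by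
    let a : Fin m ↪ Fin (m * k) :=
      ⟨fun j => finProdFinEquiv (j, (0 : Fin k)), fun i j h => by simpa using h⟩
    obtain ⟨g, hg⟩ := (Equiv.Perm.isMultiplyPretransitive (Fin (m * k)) m).exists_smul_eq a
      ((Tuple.sort z).toEmbedding.trans ι)
    exact ⟨g, fun j => DFunLike.congr_fun hg j⟩
  have hxmono : Monotone ((x ∘ g) ∘ ((Tuple.sort x).trans g.symm)) := by
    have hcomp : (x ∘ g) ∘ ((Tuple.sort x).trans g.symm) = x ∘ Tuple.sort x := by
      funext i
      simp
    rw [hcomp]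
    exact Tuple.monotone_sort x
  have hle := sum_abs_sub_comp_perm_le hymono hxmono
  rw [← Equiv.sum_comp finProdFinEquiv, ← Equiv.sum_comp finProdFinEquiv] at hle
  have hblock : ∀ j : Fin m, ∑ b : Fin k, |z (Tuple.sort z j) - x (g (finProdFinEquiv (j, b)))| ≤
      ((k : ℝ) - 1) * R := by
    intro j
    have hzero : |z (Tuple.sort z j) - x (ι (Tuple.sort z j))| = 0 := by simp [hz]
    rw [← Finset.add_sum_erase _ _ (Finset.mem_univ (0 : Fin k)), hg j, hzero, zero_add]
    refine (Finset.sum_le_card_nsmul _ _ R fun b _ => hR _ _).trans (le_of_eq ?_)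
    rw [Finset.card_erase_of_mem (Finset.mem_univ _), Finset.card_univ, Fintype.card_fin,
      nsmul_eq_mul, Nat.cast_sub NeZero.one_le, Nat.cast_one]
  calc _ ≤ ∑ p : Fin m × Fin k, |z (Tuple.sort z p.1) - x (g (finProdFinEquiv p))| := by
        simpa only [hy, Equiv.symm_apply_apply, Equiv.Perm.coe_one, id_eq, Equiv.trans_apply,
          Function.comp_apply, Equiv.apply_symm_apply] using hle
    _ ≤ ∑ j : Fin m, ((k : ℝ) - 1) * R := by
        rw [Fintype.sum_prod_type]
        exact Finset.sum_le_sum fun j _ => hblock j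
    _ = _ := by
        simp only [Finset.sum_const, Finset.card_univ, Fintype.card_fin, nsmul_eq_mul]
        push_cast
        ring

theorem card_mul_sum_embedding_apply {α : Type*} {n : ℕ} [NeZero n] [Fintype (α ↪ Fin n)]
    (x : Fin n → ℝ) (j : α) :
    (n : ℝ) * ∑ ι : α ↪ Fin n, x (ι j) = Fintype.card (α ↪ Fin n) * ∑ i, x i := by
  have hshift : ∀ a : Fin n, ∑ ι : α ↪ Fin n, x (ι j + a) = ∑ ι : α ↪ Fin n, x (ι j) := fun a =>
    Equiv.sum_comp (Equiv.embeddingCongr (Equiv.refl α) (Equiv.addRight a))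
      (fun ι : α ↪ Fin n => x (ι j))
  calc (n : ℝ) * ∑ ι : α ↪ Fin n, x (ι j) = ∑ a : Fin n, ∑ ι : α ↪ Fin n, x (ι j + a) := by
        simp [hshift]
    _ = ∑ ι : α ↪ Fin n, ∑ a : Fin n, x (ι j + a) := Finset.sum_comm
    _ = ∑ ι : α ↪ Fin n, ∑ i, x i :=
        Finset.sum_congr rfl fun ι _ => Equiv.sum_comp (Equiv.addLeft (ι j)) x
    _ = _ := by simp

/-- Bias bound for weighted order statistics under sampling without replacement. -/
theorem abs_sum_sample_sub_le {m k : ℕ} [NeZero m] [NeZero k] (x : Fin (m * k) → ℝ)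
    (σ : Fin (m * k) → ℝ) (σh : Fin m → ℝ) (hσh : ∀ j, σh j = ∑ b, σ (finProdFinEquiv (j, b)))
    {M R : ℝ} (hσ : ∀ r, |σ r - 1 / (m * k : ℕ)| ≤ M / (m * k : ℕ)) (hR : ∀ i j, |x i - x j| ≤ R) :
    |(∑ ι : Fin m ↪ Fin (m * k), ∑ j, σh j * x (ι (Tuple.sort (fun j => x (ι j)) j))) /
          (Fintype.card (Fin m ↪ Fin (m * k)) : ℝ) - ∑ r, σ r * x (Tuple.sort x r)| ≤
      M * (((m * k : ℕ) - m : ℝ) / (m * k : ℕ)) * R := by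
  have hk : 0 < k := Nat.pos_of_neZero k
  have hM : 0 ≤ M / (m * k : ℕ) := (abs_nonneg _).trans (hσ 0)
  have hC : 0 < (Fintype.card (Fin m ↪ Fin (m * k)) : ℝ) := by
    have : Nonempty (Fin m ↪ Fin (m * k)) := ⟨Fin.castLEEmb (Nat.le_mul_of_pos_right m hk)⟩
    exact_mod_cast Fintype.card_pos
  set C : ℝ := (Fintype.card (Fin m ↪ Fin (m * k)) : ℝ) with hCdef
  let D : (Fin m ↪ Fin (m * k)) → Fin m × Fin k → ℝ := fun ι p =>
    x (ι (Tuple.sort (fun j => x (ι j)) p.1)) - x (Tuple.sort x (finProdFinEquiv p))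
  have hdecomp : ∀ ι : Fin m ↪ Fin (m * k),
      ∑ j, σh j * x (ι (Tuple.sort (fun j => x (ι j)) j)) - ∑ r, σ r * x (Tuple.sort x r) =
        ∑ p, (σ (finProdFinEquiv p) - 1 / (m * k : ℕ)) * D ι p +
          1 / (m * k : ℕ) * (k * ∑ j, x (ι j) - ∑ r, x r) := by
    intro ι
    have h₁ : ∑ j, σh j * x (ι (Tuple.sort (fun j => x (ι j)) j)) =
        ∑ p : Fin m × Fin k,
          σ (finProdFinEquiv p) * x (ι (Tuple.sort (fun j => x (ι j)) p.1)) := by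
      rw [Fintype.sum_prod_type]
      exact Finset.sum_congr rfl fun j _ => by rw [hσh, Finset.sum_mul]
    have h₂ : k * ∑ j, x (ι j) =
        ∑ p : Fin m × Fin k, x (ι (Tuple.sort (fun j => x (ι j)) p.1)) := by
      rw [Fintype.sum_prod_type, ← Equiv.sum_comp (Tuple.sort fun j => x (ι j))]
      simp [Finset.mul_sum]
    have h₃ : ∑ r, x r = ∑ p : Fin m × Fin k, x (Tuple.sort x (finProdFinEquiv p)) := by
      rw [Equiv.sum_comp finProdFinEquiv fun r => x (Tuple.sort x r), Equiv.sum_comp]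
    rw [h₁, h₂, h₃, ← Equiv.sum_comp finProdFinEquiv fun r => σ r * x (Tuple.sort x r),
      ← Finset.sum_sub_distrib, ← Finset.sum_sub_distrib, Finset.mul_sum,
      ← Finset.sum_add_distrib]
    exact Finset.sum_congr rfl fun p _ => by simp only [D]; ring
  have hmean : ∑ ι : Fin m ↪ Fin (m * k), (k * ∑ j, x (ι j) - ∑ r, x r) = 0 := by
    have h : ((m * k : ℕ) : ℝ) * ∑ ι : Fin m ↪ Fin (m * k), ∑ j, x (ι j) =
        m * (C * ∑ r, x r) := by
      rw [Finset.sum_comm, Finset.mul_sum]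
      simp only [card_mul_sum_embedding_apply x]
      simp [hCdef]
    have hm : (m : ℝ) ≠ 0 := NeZero.ne _
    have h' : (k : ℝ) * ∑ ι : Fin m ↪ Fin (m * k), ∑ j, x (ι j) = C * ∑ r, x r := by
      apply mul_left_cancel₀ hm
      rw [← h, ← mul_assoc, Nat.cast_mul]
    rw [Finset.sum_sub_distrib, ← Finset.mul_sum, h']
    simp [hCdef]
  have hbound : ∀ ι : Fin m ↪ Fin (m * k),
      |∑ p, (σ (finProdFinEquiv p) - 1 / (m * k : ℕ)) * D ι p| ≤
        M * (((m * k : ℕ) - m : ℝ) / (m * k : ℕ)) * R := by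
    intro ι
    calc _ ≤ ∑ p, |(σ (finProdFinEquiv p) - 1 / (m * k : ℕ)) * D ι p| :=
          Finset.abs_sum_le_sum_abs _ _
      _ ≤ ∑ p, M / (m * k : ℕ) * |D ι p| := Finset.sum_le_sum fun p _ => by
          rw [abs_mul]
          exact mul_le_mul_of_nonneg_right (hσ _) (abs_nonneg _)
      _ = M / (m * k : ℕ) * ∑ p, |D ι p| := by rw [Finset.mul_sum]
      _ ≤ M / (m * k : ℕ) * (((m * k : ℕ) - m : ℝ) * R) :=
          mul_le_mul_of_nonneg_left (sum_abs_sample_sub_le x ι hR) hM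
      _ = _ := by ring
  set T := ∑ r, σ r * x (Tuple.sort x r) with hT
  have hsum : (∑ ι : Fin m ↪ Fin (m * k),
        ∑ j, σh j * x (ι (Tuple.sort (fun j => x (ι j)) j))) - C * T =
      ∑ ι : Fin m ↪ Fin (m * k),
        ∑ p, (σ (finProdFinEquiv p) - 1 / (m * k : ℕ)) * D ι p := by
    have h := Finset.sum_congr (rfl : (Finset.univ : Finset (Fin m ↪ Fin (m * k))) = Finset.univ)
      fun ι _ => hdecomp ι
    rw [Finset.sum_sub_distrib, Finset.sum_add_distrib, ← Finset.mul_sum, hmean, mul_zero,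
      add_zero] at h
    rw [← h, Finset.sum_const, Finset.card_univ, nsmul_eq_mul]
  rw [div_sub' hC.ne', hsum, abs_div, abs_of_pos hC, div_le_iff₀ hC]
  calc _ ≤ ∑ ι : Fin m ↪ Fin (m * k),
          |∑ p, (σ (finProdFinEquiv p) - 1 / (m * k : ℕ)) * D ι p| :=
        Finset.abs_sum_le_sum_abs _ _
    _ ≤ ∑ ι : Fin m ↪ Fin (m * k), M * (((m * k : ℕ) - m : ℝ) / (m * k : ℕ)) * R :=
        Finset.sum_le_sum fun ι _ => hbound ι
    _ = _ := by rw [Finset.sum_const, Finset.card_univ, nsmul_eq_mul, mul_comm]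

theorem intervalIntegrable_of_integrableOn_Ioo {s : ℝ → ℝ}
    (hs : MeasureTheory.IntegrableOn s (Set.Ioo 0 1)) {a b : ℝ} (ha : 0 ≤ a) (hab : a ≤ b)
    (hb : b ≤ 1) : IntervalIntegrable s MeasureTheory.volume a b := by
  rw [intervalIntegrable_iff_integrableOn_Ioo_of_le hab]
  exact hs.mono_set (Set.Ioo_subset_Ioo ha hb)

theorem abs_intervalIntegral_sub_le {s : ℝ → ℝ}
    (hs : MeasureTheory.IntegrableOn s (Set.Ioo 0 1)) {M : ℝ}
    (hM : ∀ t ∈ Set.Ioo (0 : ℝ) 1, |s t - 1| ≤ M) {a b : ℝ} (ha : 0 ≤ a) (hab : a ≤ b)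
    (hb : b ≤ 1) : |(∫ t in a..b, s t) - (b - a)| ≤ M * (b - a) := by
  have hint := intervalIntegrable_of_integrableOn_Ioo hs ha hab hb
  have heq : (∫ t in a..b, s t) - (b - a) = ∫ t in a..b, (s t - 1) := by
    rw [intervalIntegral.integral_sub hint intervalIntegrable_const]
    simp
  have hae : ∀ᵐ t, t ∈ Set.uIoc a b → ‖s t - 1‖ ≤ M := by
    filter_upwards [MeasureTheory.Measure.ae_ne MeasureTheory.volume b] with t htb ht
    rw [Set.uIoc_of_le hab] at ht
    exact hM t ⟨ha.trans_lt ht.1, (lt_of_le_of_ne ht.2 htb).trans_le hb⟩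
  rw [heq]
  simpa [abs_of_nonneg (sub_nonneg.mpr hab)] using
    intervalIntegral.norm_integral_le_of_norm_le_const_ae hae

theorem intervalIntegral_eq_sum_blocks {s : ℝ → ℝ}
    (hs : MeasureTheory.IntegrableOn s (Set.Ioo 0 1)) {m k : ℕ} [NeZero m] [NeZero k] (j : Fin m) :
    ∫ t in ((j : ℝ) / m)..(((j : ℝ) + 1) / m), s t =
      ∑ b : Fin k, ∫ t in (((finProdFinEquiv (j, b) : Fin (m * k)) : ℕ) : ℝ) / (m * k : ℕ)..
        ((((finProdFinEquiv (j, b) : Fin (m * k)) : ℕ) : ℝ) + 1) / (m * k : ℕ), s t := by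
  have hm : (m : ℝ) ≠ 0 := NeZero.ne _
  have hk : (k : ℝ) ≠ 0 := NeZero.ne _
  have hmk : 0 < ((m * k : ℕ) : ℝ) := by exact_mod_cast Nat.pos_of_neZero (m * k)
  let a : ℕ → ℝ := fun b => ((b : ℝ) + k * j) / (m * k : ℕ)
  have hsum := intervalIntegral.sum_integral_adjacent_intervals (f := s)
    (μ := MeasureTheory.volume) (a := a) (n := k) (fun b hb => by
      refine intervalIntegrable_of_integrableOn_Ioo hs (by positivity) ?_ ?_
      · simp only [a]; gcongr; simp
      · simp only [a]
        rw [div_le_one hmk]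
        have := (finProdFinEquiv (j, (⟨b, hb⟩ : Fin k))).isLt
        simp only [finProdFinEquiv_apply_val] at this
        have h' : b + 1 + k * j ≤ m * k := by omega
        exact_mod_cast h')
  have h0 : a 0 = (j : ℝ) / m := by simp only [a]; push_cast; field_simp; ring
  have h1 : a k = ((j : ℝ) + 1) / m := by simp only [a]; push_cast; field_simp; ring
  rw [h0, h1, ← Fin.sum_univ_eq_sum_range (fun b => ∫ t in a b..a (b + 1), s t)] at hsum
  rw [← hsum]
  refine Finset.sum_congr rfl fun b _ => ?_
  simp only [a, finProdFinEquiv_apply_val]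
  congr 1 <;> push_cast <;> ring

/-- Uniform bias bound for the minibatch spectral risk: for convex
`G`-Lipschitz losses and a bounded density `s`, over the ball `‖w‖ ≤ G/μ`,
`|E[R_σ̂(w)] − R_σ(w)| ≤ ‖s − u‖_∞ ((n−m)/n) B`, where the expectation averages over all
injections `Fin m ↪ Fin n` (sampling without replacement) and
`B = sup_{‖w‖ ≤ G/μ} (ℓ₍ₙ₎(w) − ℓ₍₁₎(w))`. -/
theorem stmt10 {d n m : ℕ} [NeZero n] [NeZero m] (hdvd : m ∣ n) (hle : m ≤ n)
    (ℓ : Fin n → EuclideanSpace ℝ (Fin d) → ℝ)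
    (hconv : ∀ i, ConvexOn ℝ Set.univ (ℓ i))
    (hcont : ∀ i, Continuous (ℓ i))
    (G : ℝ≥0) (hlip : ∀ i, LipschitzWith G (ℓ i))
    (s : ℝ → ℝ)
    (hs_nonneg : ∀ t ∈ Set.Ioo (0 : ℝ) 1, 0 ≤ s t)
    (hs_density : ∫ t in Set.Ioo (0 : ℝ) 1, s t = 1)
    (hs_bdd : BddAbove ((fun t => |s t|) '' Set.Ioo (0 : ℝ) 1))
    (σ : Fin n → ℝ) (hσ : ∀ i : Fin n, σ i = ∫ t in ((i : ℝ) / n)..(((i : ℝ) + 1) / n), s t)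
    (σh : Fin m → ℝ) (hσh : ∀ j : Fin m, σh j = ∫ t in ((j : ℝ) / m)..(((j : ℝ) + 1) / m), s t)
    (μ : ℝ) (hμ : 0 < μ)
    (B : ℝ)
    (hB : B = sSup ((fun w =>
      Finset.univ.sup' Finset.univ_nonempty (fun i => ℓ i w) -
        Finset.univ.inf' Finset.univ_nonempty (fun i => ℓ i w)) ''
      {w : EuclideanSpace ℝ (Fin d) | ‖w‖ ≤ (G : ℝ) / μ})) :
    ∀ w : EuclideanSpace ℝ (Fin d), ‖w‖ ≤ (G : ℝ) / μ →
      |(∑ ι : Fin m ↪ Fin n, spectralRisk σh (fun j => ℓ (ι j)) w) /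
            (Fintype.card (Fin m ↪ Fin n) : ℝ) -
          spectralRisk σ ℓ w| ≤
        sSup ((fun t => |s t - 1|) '' Set.Ioo (0 : ℝ) 1) * (((n : ℝ) - m) / n) * B := by
  intro w hw
  obtain ⟨k, rfl⟩ := hdvd
  have : NeZero k := ⟨fun hk => NeZero.ne (m * k) (by simp [hk])⟩
  have hn : 0 < ((m * k : ℕ) : ℝ) := by exact_mod_cast Nat.pos_of_neZero (m * k)
  have hsint : MeasureTheory.IntegrableOn s (Set.Ioo 0 1) :=
    MeasureTheory.Integrable.of_integral_ne_zero (by rw [hs_density]; exact one_ne_zero)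
  have hbdd : BddAbove ((fun t => |s t - 1|) '' Set.Ioo (0 : ℝ) 1) := by
    obtain ⟨K, hK⟩ := hs_bdd
    refine ⟨K + 1, ?_⟩
    rintro _ ⟨t, ht, rfl⟩
    have h := abs_sub (s t) 1
    have h' : |s t| ≤ K := hK ⟨t, ht, rfl⟩
    simp only [abs_one] at h
    linarith
  set F : EuclideanSpace ℝ (Fin d) → ℝ := fun w =>
    Finset.univ.sup' Finset.univ_nonempty (fun i => ℓ i w) -
      Finset.univ.inf' Finset.univ_nonempty (fun i => ℓ i w) with hF
  have hFcont : Continuous F :=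
    (Continuous.finset_sup'_apply _ fun i _ => hcont i).sub
      (Continuous.finset_inf'_apply _ fun i _ => hcont i)
  have hball : IsCompact {w : EuclideanSpace ℝ (Fin d) | ‖w‖ ≤ (G : ℝ) / μ} := by
    simpa [Metric.closedBall, dist_zero_right] using
      isCompact_closedBall (0 : EuclideanSpace ℝ (Fin d)) ((G : ℝ) / μ)
  have hFB : F w ≤ B := by
    rw [hB]
    exact le_csSup (hball.bddAbove_image hFcont.continuousOn) ⟨w, hw, rfl⟩
  have hR : ∀ i j, |ℓ i w - ℓ j w| ≤ B := by
    intro i j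
    have hsup := fun i => Finset.le_sup' (fun i => ℓ i w) (Finset.mem_univ i)
    have hinf := fun i => Finset.inf'_le (fun i => ℓ i w) (Finset.mem_univ i)
    refine le_trans ?_ hFB
    rw [abs_le]
    constructor <;> simp only [hF] <;> linarith [hsup i, hsup j, hinf i, hinf j]
  refine abs_sum_sample_sub_le (fun i => ℓ i w) σ σh (fun j => ?_) (fun r => ?_) hR
  · simp only [hσh, hσ]
    exact intervalIntegral_eq_sum_blocks hsint j
  · have hr : ((r : ℕ) : ℝ) + 1 ≤ (m * k : ℕ) := by exact_mod_cast r.isLt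
    have h := abs_intervalIntegral_sub_le hsint (fun t ht => le_csSup hbdd ⟨t, ht, rfl⟩)
      (a := (r : ℝ) / (m * k : ℕ)) (b := ((r : ℝ) + 1) / (m * k : ℕ)) (by positivity)
      (by gcongr; simp) ((div_le_one hn).mpr hr)
    rw [← sub_div, add_sub_cancel_left, ← hσ r, mul_one_div] at h
    exact h
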